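/- The 3-forms φ_1 = e^{124} + e^{134} + e^{256} + e^{378} + e^{157} + e^{468}, φ_2 = e^{135} + e^{245} + e^{146} − e^{236} + e^{127} + e^{348} + e^{678}, and φ_3 = e^{135} − e^{146} + e^{236} + e^{245} + e^{347} + e^{568} + e^{127} + e^{128} on ℝ^8 are all stable (each has an open GL(8,ℝ)-orbit), and they are pairwise inequivalent (no two of them lie in the same GL(8,ℝ)-orbit). -/

import Mathlib

noncomputable section

/-- The wedge product `f 0 ∧ ⋯ ∧ f (k-1)` of `k` covectors, as an alternating `k`-form:
`(v₁,…,v_k) ↦ det (f i (v j))`. -/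
def covectorWedge {V : Type*} [AddCommGroup V] [Module ℝ V] {k : ℕ}
    (f : Fin k → Module.Dual ℝ V) : V [⋀^Fin k]→ₗ[ℝ] ℝ :=
  (Matrix.detRowAlternating : (Fin k → ℝ) [⋀^Fin k]→ₗ[ℝ] ℝ).compLinearMap (LinearMap.pi f)

/-- The natural topology on the finite-dimensional space of alternating `k`-forms on `ℝⁿ`
(the topology induced by evaluation; it coincides with the standard vector space topology). -/
instance altFormTopology (n k : ℕ) :
    TopologicalSpace ((Fin n → ℝ) [⋀^Fin k]→ₗ[ℝ] ℝ) :=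
  TopologicalSpace.induced (fun φ => (⇑φ : (Fin k → Fin n → ℝ) → ℝ)) inferInstance

/-- The pullback `g^*γ` of a `k`-form on `ℝⁿ` by a linear map `g`:
`(g^*γ)(v₁,…,v_k) = γ (g v₁, …, g v_k)`. -/
def formPullback {n k : ℕ} (g : (Fin n → ℝ) →ₗ[ℝ] (Fin n → ℝ))
    (γ : (Fin n → ℝ) [⋀^Fin k]→ₗ[ℝ] ℝ) : (Fin n → ℝ) [⋀^Fin k]→ₗ[ℝ] ℝ :=
  γ.compLinearMap g

/-- A `k`-form on `ℝⁿ` is stable if its `GL(n,ℝ)`-orbit (under pullback) is open in the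
space of all alternating `k`-forms. -/
def IsStableForm {n k : ℕ} (γ : (Fin n → ℝ) [⋀^Fin k]→ₗ[ℝ] ℝ) : Prop :=
  IsOpen {φ : (Fin n → ℝ) [⋀^Fin k]→ₗ[ℝ] ℝ |
    ∃ g : (Fin n → ℝ) ≃ₗ[ℝ] (Fin n → ℝ), φ = formPullback g.toLinearMap γ}

/-- `e^i ∧ e^j ∧ e^k` on `ℝⁿ`, where `e^1,…,e^n` is the dual of the standard basis
(here indexed from `0`, so the paper's `e^{pqr}` is `eee (p-1) (q-1) (r-1)`). -/
def eee {n : ℕ} (i j k : Fin n) : (Fin n → ℝ) [⋀^Fin 3]→ₗ[ℝ] ℝ :=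
  covectorWedge ![LinearMap.proj i, LinearMap.proj j, LinearMap.proj k]

/-- The form `φ₁ = e^{124} + e^{134} + e^{256} + e^{378} + e^{157} + e^{468}` on `ℝ⁸`
(of `SL(3,ℝ)`-type, Djokovic's form XXIIIa). -/
def phiOne : (Fin 8 → ℝ) [⋀^Fin 3]→ₗ[ℝ] ℝ :=
  eee 0 1 3 + eee 0 2 3 + eee 1 4 5 + eee 2 6 7 + eee 0 4 6 + eee 3 5 7

/-- The form `φ₂ = e^{135} + e^{245} + e^{146} - e^{236} + e^{127} + e^{348} + e^{678}` on `ℝ⁸`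
(of `PSU(1,2)`-type, Djokovic's form XXIIIb). -/
def phiTwo : (Fin 8 → ℝ) [⋀^Fin 3]→ₗ[ℝ] ℝ :=
  eee 0 2 4 + eee 1 3 4 + eee 0 3 5 - eee 1 2 5 + eee 0 1 6 + eee 2 3 7 + eee 5 6 7

/-- The form `φ₃ = e^{135} - e^{146} + e^{236} + e^{245} + e^{347} + e^{568} + e^{127} + e^{128}`
on `ℝ⁸` (of `PSU(3)`-type, Djokovic's form XXIIIc). -/
def phiThree : (Fin 8 → ℝ) [⋀^Fin 3]→ₗ[ℝ] ℝ :=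
  eee 0 2 4 - eee 0 3 5 + eee 1 2 5 + eee 1 3 4 + eee 2 3 6 + eee 4 5 7 + eee 0 1 6 + eee 0 1 7

variable {n k : ℕ}

/-- The Lie algebra of the stabilizer of a `k`-form in `GL(n,ℝ)`. -/
def infinitesimalStabilizer (γ : (Fin n → ℝ) [⋀^Fin k]→ₗ[ℝ] ℝ) :
    Submodule ℝ (Module.End ℝ (Fin n → ℝ)) where
  carrier := {A | ∀ v, ∑ i, γ (Function.update v i (A (v i))) = 0}
  add_mem' {A B} hA hB v := by
    simp only [LinearMap.add_apply, AlternatingMap.map_update_add, Finset.sum_add_distrib,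
      hA v, hB v, add_zero]
  zero_mem' v := by simp
  smul_mem' c A hA v := by
    simp only [LinearMap.smul_apply, AlternatingMap.map_update_smul, ← Finset.smul_sum, hA v,
      smul_zero]

theorem eee_apply (i j k : Fin n) (v : Fin 3 → Fin n → ℝ) :
    eee i j k v = v 0 i * v 1 j * v 2 k - v 0 i * v 1 k * v 2 j - v 0 j * v 1 i * v 2 k
      + v 0 j * v 1 k * v 2 i + v 0 k * v 1 i * v 2 j - v 0 k * v 1 j * v 2 i := by
  refine (Matrix.det_fin_three _).trans ?_
  simp

theorem infinitesimalStabilizer_entries {γ : (Fin n → ℝ) [⋀^Fin 3]→ₗ[ℝ] ℝ}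
    {a : Matrix (Fin n) (Fin n) ℝ} (ha : a.toLin' ∈ infinitesimalStabilizer γ) (i j k : Fin n) :
    γ ![a.col i, Pi.single j 1, Pi.single k 1] + γ ![Pi.single i 1, a.col j, Pi.single k 1] +
      γ ![Pi.single i 1, Pi.single j 1, a.col k] = 0 := by
  have := ha ![Pi.single i 1, Pi.single j 1, Pi.single k 1]
  have h0 (u v w u' : Fin n → ℝ) : Function.update ![u, v, w] 0 u' = ![u', v, w] := by
    ext l; fin_cases l <;> rfl
  have h1 (u v w v' : Fin n → ℝ) : Function.update ![u, v, w] 1 v' = ![u, v', w] := by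
    ext l; fin_cases l <;> rfl
  have h2 (u v w w' : Fin n → ℝ) : Function.update ![u, v, w] 2 w' = ![u, v, w'] := by
    ext l; fin_cases l <;> rfl
  simpa [Fin.sum_univ_three, h0, h1, h2] using this

open Filter Topology in
theorem isStableForm_of_mem_nhds {γ : (Fin n → ℝ) [⋀^Fin k]→ₗ[ℝ] ℝ}
    (h : {φ : (Fin n → ℝ) [⋀^Fin k]→ₗ[ℝ] ℝ |
    ∃ g : (Fin n → ℝ) ≃ₗ[ℝ] (Fin n → ℝ), φ = formPullback g.toLinearMap γ} ∈ 𝓝 γ) :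
    IsStableForm γ := by
  have hcont (g : (Fin n → ℝ) →ₗ[ℝ] (Fin n → ℝ)) :
      Continuous fun φ : (Fin n → ℝ) [⋀^Fin k]→ₗ[ℝ] ℝ => formPullback g φ := by
    rw [continuous_induced_rng]
    refine continuous_pi fun v => ?_
    exact (continuous_apply (fun i => g (v i))).comp continuous_induced_dom
  refine isOpen_iff_mem_nhds.2 ?_
  rintro _ ⟨g, rfl⟩
  have hγ : formPullback g.symm.toLinearMap (formPullback g.toLinearMap γ) = γ := by
    ext v; simp [formPullback]
  have := (hcont g.symm.toLinearMap).continuousAt.preimage_mem_nhds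
    (x := formPullback g.toLinearMap γ) (by simpa only [hγ] using h)
  refine mem_of_superset this ?_
  rintro φ ⟨e, he⟩
  refine ⟨g.trans e, ?_⟩
  ext v
  simpa [formPullback] using DFunLike.congr_fun he (fun i => g (v i))

theorem finrank_alternatingMap (n k : ℕ) :
    Module.finrank ℝ ((Fin n → ℝ) [⋀^Fin k]→ₗ[ℝ] ℝ) = n.choose k := by
  rw [exteriorPower.alternatingMapLinearEquiv.finrank_eq, Module.finrank_linearMap]
  simp [exteriorPower.finrank_eq]

instance (n k : ℕ) : Module.Finite ℝ ((Fin n → ℝ) [⋀^Fin k]→ₗ[ℝ] ℝ) :=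
  Module.Finite.equiv exteriorPower.alternatingMapLinearEquiv.symm

/-- An alternating form, viewed as a function on tuples of vectors. -/
def altEval (n k : ℕ) : ((Fin n → ℝ) [⋀^Fin k]→ₗ[ℝ] ℝ) →ₗ[ℝ] ((Fin k → Fin n → ℝ) → ℝ) where
  toFun φ := φ
  map_add' _ _ := rfl
  map_smul' _ _ := rfl

instance (n k : ℕ) : IsTopologicalAddGroup ((Fin n → ℝ) [⋀^Fin k]→ₗ[ℝ] ℝ) :=
  topologicalAddGroup_induced (altEval n k)

instance (n k : ℕ) : ContinuousSMul ℝ ((Fin n → ℝ) [⋀^Fin k]→ₗ[ℝ] ℝ) :=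
  continuousSMul_induced (altEval n k)

instance (n k : ℕ) : T2Space ((Fin n → ℝ) [⋀^Fin k]→ₗ[ℝ] ℝ) :=
  .of_injective_continuous (DFunLike.coe_injective) continuous_induced_dom

theorem MultilinearMap.continuous_of_pi (f : MultilinearMap ℝ (fun _ : Fin k => Fin n → ℝ) ℝ) :
    Continuous f := by
  have hf (v : Fin k → Fin n → ℝ) : f v =
      ∑ r : Fin k → Fin n, (∏ i, v i (r i)) * f fun i => Pi.single (r i) 1 := by
    conv_lhs => rw [show v = fun i => ∑ j, v i j • Pi.single j (1 : ℝ) from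
      funext fun i => pi_eq_sum_univ' (v i)]
    rw [f.map_sum]
    simp only [f.map_smul_univ, smul_eq_mul]
  rw [show (f : (Fin k → Fin n → ℝ) → ℝ) = _ from funext hf]
  fun_prop

/-- Every alternating form on `ℝⁿ` is continuous. -/
def toContinuousForm (n k : ℕ) :
    ((Fin n → ℝ) [⋀^Fin k]→ₗ[ℝ] ℝ) ≃ₗ[ℝ] ((Fin n → ℝ) [⋀^Fin k]→L[ℝ] ℝ) :=
  (LinearEquiv.ofBijective ContinuousAlternatingMap.toAlternatingMapLinear
    ⟨ContinuousAlternatingMap.toAlternatingMap_injective, fun f =>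
      ⟨{ f with cont := f.toMultilinearMap.continuous_of_pi }, rfl⟩⟩).symm

theorem toContinuousForm_apply (φ : (Fin n → ℝ) [⋀^Fin k]→ₗ[ℝ] ℝ) (v) :
    toContinuousForm n k φ v = φ v := by
  have : (toContinuousForm n k).symm (toContinuousForm n k φ) = φ := by simp
  exact DFunLike.congr_fun this v

open Filter Topology in
theorem isStableForm_of_infinitesimalStabilizer {m : ℕ} {γ : (Fin n → ℝ) [⋀^Fin k]→ₗ[ℝ] ℝ}
    (hm : m + n.choose k ≤ n * n)
    (L : Module.End ℝ (Fin n → ℝ) →ₗ[ℝ] (Fin m → ℝ))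
    (hL : ∀ A ∈ infinitesimalStabilizer γ, L A = 0 → A = 0) :
    IsStableForm γ := by
  refine isStableForm_of_mem_nhds ?_
  have : FiniteDimensional ℝ ((Fin n → ℝ) [⋀^Fin k]→L[ℝ] ℝ) :=
    (toContinuousForm n k).finiteDimensional
  let e := (toContinuousForm n k).toContinuousLinearEquiv
  let D := (toContinuousForm n k γ).fderivCompContinuousLinearMap (.id ℝ (Fin n → ℝ))
  have hD : HasStrictFDerivAt
      (fun g : (Fin n → ℝ) →L[ℝ] (Fin n → ℝ) => (toContinuousForm n k γ).compContinuousLinearMap g)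
      D (.id ℝ (Fin n → ℝ)) := by
    simpa using (hasStrictFDerivAt_const (𝕜 := ℝ) (toContinuousForm n k γ)
      (ContinuousLinearMap.id ℝ (Fin n → ℝ))).continuousAlternatingMapCompContinuousLinearMap
        (hasStrictFDerivAt_id _)
  have hker (A) (hA : D A = 0) : A.toLinearMap ∈ infinitesimalStabilizer γ := by
    intro v
    have := DFunLike.congr_fun hA v
    rw [ContinuousAlternatingMap.fderivCompContinuousLinearMap_apply] at this
    simp only [toContinuousForm_apply] at this
    refine Eq.trans ?_ this
    refine Finset.sum_congr rfl fun i _ => congrArg γ (funext fun j => ?_)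
    rcases eq_or_ne j i with rfl | hj <;> simp [*]
  have hsurj : D.range = ⊤ := by
    apply Submodule.eq_top_of_finrank_eq
    have h1 := D.toLinearMap.finrank_range_add_finrank_ker
    have h2 : Module.finrank ℝ D.ker ≤ m := by
      have := LinearMap.finrank_le_finrank_of_injective (f :=
        L ∘ₗ ContinuousLinearMap.coeLM ℝ ∘ₗ D.ker.subtype) (by
          rw [injective_iff_map_eq_zero]
          intro A hA
          have := hL _ (hker A A.2) hA
          ext1
          exact ContinuousLinearMap.coe_injective this)
      simpa using this
    have h3 : Module.finrank ℝ ((Fin n → ℝ) →L[ℝ] (Fin n → ℝ)) = n * n := by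
      rw [← LinearMap.toContinuousLinearMap.finrank_eq, Module.finrank_linearMap]
      simp
    have h4 := D.range.finrank_le
    rw [← (toContinuousForm n k).finrank_eq, finrank_alternatingMap] at h4 ⊢
    change Module.finrank ℝ D.range + Module.finrank ℝ D.ker = _ at h1
    omega
  have hmap := hD.map_nhds_eq_of_surj hsurj
  have hU : {g : (Fin n → ℝ) →L[ℝ] (Fin n → ℝ) | IsUnit g} ∈ 𝓝 (.id ℝ (Fin n → ℝ)) :=
    Units.isOpen.mem_nhds isUnit_one
  have := image_mem_map (m := fun g => (toContinuousForm n k γ).compContinuousLinearMap g) hU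
  rw [hmap] at this
  have h5 := e.continuous.continuousAt.preimage_mem_nhds (x := γ) (this)
  refine mem_of_superset h5 ?_
  rintro φ ⟨_, ⟨g, rfl⟩, hg⟩
  refine ⟨(ContinuousLinearEquiv.ofUnit g).toLinearEquiv, ?_⟩
  ext v
  have := DFunLike.congr_fun hg v
  exact (toContinuousForm_apply φ v).symm.trans (this.symm.trans (toContinuousForm_apply γ _))

theorem forall_increasing_triple {P : Fin 8 → Fin 8 → Fin 8 → Prop} (h : ∀ i j k, P i j k) :
    P 0 1 2 ∧ P 0 1 3 ∧ P 0 1 4 ∧ P 0 1 5 ∧ P 0 1 6 ∧ P 0 1 7 ∧ P 0 2 3 ∧ P 0 2 4 ∧ P 0 2 5 ∧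
    P 0 2 6 ∧ P 0 2 7 ∧ P 0 3 4 ∧ P 0 3 5 ∧ P 0 3 6 ∧ P 0 3 7 ∧ P 0 4 5 ∧ P 0 4 6 ∧ P 0 4 7 ∧
    P 0 5 6 ∧ P 0 5 7 ∧ P 0 6 7 ∧ P 1 2 3 ∧ P 1 2 4 ∧ P 1 2 5 ∧ P 1 2 6 ∧ P 1 2 7 ∧ P 1 3 4 ∧
    P 1 3 5 ∧ P 1 3 6 ∧ P 1 3 7 ∧ P 1 4 5 ∧ P 1 4 6 ∧ P 1 4 7 ∧ P 1 5 6 ∧ P 1 5 7 ∧ P 1 6 7 ∧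
    P 2 3 4 ∧ P 2 3 5 ∧ P 2 3 6 ∧ P 2 3 7 ∧ P 2 4 5 ∧ P 2 4 6 ∧ P 2 4 7 ∧ P 2 5 6 ∧ P 2 5 7 ∧
    P 2 6 7 ∧ P 3 4 5 ∧ P 3 4 6 ∧ P 3 4 7 ∧ P 3 5 6 ∧ P 3 5 7 ∧ P 3 6 7 ∧ P 4 5 6 ∧ P 4 5 7 ∧
    P 4 6 7 ∧ P 5 6 7 := by
  simp only [h, and_self]

set_option maxHeartbeats 1000000 in
theorem eq_of_mem_infinitesimalStabilizer_phiOne {a : Matrix (Fin 8) (Fin 8) ℝ}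
    (ha : a.toLin' ∈ infinitesimalStabilizer phiOne) :
    a = !![a 0 0, a 0 1, a 0 1, 0, 0, a 0 5, 0, a 0 7;
           a 1 0, 0, 0, a 0 1, 2 * a 0 7, a 1 5, a 0 5, a 1 7;
           a 1 0, 0, 0, a 0 1, -a 0 7, -a 1 5 / 2, -2 * a 0 5, -2 * a 1 7;
           0, a 1 0, a 1 0, -a 0 0, -a 1 7, 0, -a 1 5 / 2, 0;
           0, a 1 5 / 2, 0, -a 0 5, a 4 4, 0, 0, a 1 0;
           a 1 7, a 0 7, 0, 0, 0, -a 4 4, -a 0 1, 0;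
           0, 0, -a 1 7, -a 0 7, 0, -a 1 0, -a 0 0 - a 4 4, 0;
           a 1 5 / 2, 0, -a 0 5, 0, a 0 1, 0, 0, a 0 0 + a 4 4] := by
  have h := forall_increasing_triple (infinitesimalStabilizer_entries ha)
  simp only [phiOne, AlternatingMap.add_apply, eee_apply,
    Matrix.cons_val, Matrix.col_apply, Pi.single_apply, Fin.reduceEq, ↓reduceIte, mul_one, mul_zero,
    sub_zero, zero_sub, add_zero, zero_add] at h
  rw [← Matrix.ext_iff]
  simp [Fin.forall_fin_succ]
  grind

set_option maxHeartbeats 1000000 in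
theorem eq_of_mem_infinitesimalStabilizer_phiTwo {a : Matrix (Fin 8) (Fin 8) ℝ}
    (ha : a.toLin' ∈ infinitesimalStabilizer phiTwo) :
    a = !![a 0 0, a 0 1, a 0 2, 0, a 0 4, a 0 5, 0, a 0 7;
           -a 0 1, a 0 0, 0, a 0 2, -a 0 5, a 0 4, 0, a 1 7;
           a 2 0, 0, -a 0 0, a 0 1, a 1 7, -a 0 7, -a 0 5, 0;
           0, a 2 0, -a 0 1, -a 0 0, -a 0 7, -a 1 7, -a 0 4, 0;
           -3 * a 0 7, -3 * a 1 7, 3 * a 0 5, 3 * a 0 4, 0, 0, 0, 0;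
           a 1 7, -a 0 7, a 0 4, -a 0 5, 0, 0, -a 0 2, -a 2 0;
           0, 0, -2 * a 1 7, 2 * a 0 7, 0, -2 * a 2 0, -2 * a 0 0, 0;
           -2 * a 0 4, 2 * a 0 5, 0, 0, 0, -2 * a 0 2, 0, 2 * a 0 0] := by
  have h := forall_increasing_triple (infinitesimalStabilizer_entries ha)
  simp only [phiTwo, AlternatingMap.add_apply, AlternatingMap.sub_apply, eee_apply,
    Matrix.cons_val, Matrix.col_apply, Pi.single_apply, Fin.reduceEq, ↓reduceIte, mul_one, mul_zero,
    sub_zero, zero_sub, add_zero, zero_add] at h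
  rw [← Matrix.ext_iff]
  simp [Fin.forall_fin_succ]
  grind

set_option maxHeartbeats 1000000 in
theorem eq_of_mem_infinitesimalStabilizer_phiThree {a : Matrix (Fin 8) (Fin 8) ℝ}
    (ha : a.toLin' ∈ infinitesimalStabilizer phiThree) :
    a = !![0, a 0 1, a 0 2, a 0 3, a 0 4, a 0 5, a 0 6, a 0 6;
           -a 0 1, 0, -a 0 3, a 0 2, -a 0 5, a 0 4, a 1 6, a 1 6;
           -a 0 2, a 0 3, 0, a 2 3, a 1 6, -a 0 6, -a 0 5, 0;
           -a 0 3, -a 0 2, -a 2 3, 0, -a 0 6, -a 1 6, -a 0 4, 0;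
           -a 0 4, a 0 5, -a 1 6, a 0 6, 0, a 0 1 - a 2 3, 0, a 0 3;
           -a 0 5, -a 0 4, a 0 6, a 1 6, -a 0 1 + a 2 3, 0, 0, a 0 2;
           -2 * a 0 6, -2 * a 1 6, 4 * a 0 5, 4 * a 0 4, 2 * a 0 3, 2 * a 0 2, 0, 0;
           -2 * a 0 6, -2 * a 1 6, -2 * a 0 5, -2 * a 0 4, -4 * a 0 3, -4 * a 0 2, 0, 0] := by
  have h := forall_increasing_triple (infinitesimalStabilizer_entries ha)
  simp only [phiThree, AlternatingMap.add_apply, AlternatingMap.sub_apply, eee_apply,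
    Matrix.cons_val, Matrix.col_apply, Pi.single_apply, Fin.reduceEq, ↓reduceIte, mul_one, mul_zero,
    sub_zero, zero_sub, add_zero, zero_add] at h
  rw [← Matrix.ext_iff]
  simp [Fin.forall_fin_succ]
  grind

theorem conj_mem_infinitesimalStabilizer {γ γ' : (Fin n → ℝ) [⋀^Fin k]→ₗ[ℝ] ℝ}
    {g : (Fin n → ℝ) ≃ₗ[ℝ] (Fin n → ℝ)} (hg : formPullback g.toLinearMap γ = γ')
    {A : Module.End ℝ (Fin n → ℝ)} (hA : A ∈ infinitesimalStabilizer γ) :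
    g.symm.conj A ∈ infinitesimalStabilizer γ' := by
  subst hg
  intro v
  rw [← hA fun i => g (v i)]
  refine Finset.sum_congr rfl fun i _ => congrArg γ (funext fun j => ?_)
  rcases eq_or_ne j i with rfl | hj <;> simp [LinearEquiv.conj_apply, *]

theorem trace_conj_sq (g : (Fin n → ℝ) ≃ₗ[ℝ] (Fin n → ℝ)) (A : Module.End ℝ (Fin n → ℝ)) :
    LinearMap.trace ℝ _ (g.conj A * g.conj A) = LinearMap.trace ℝ _ (A * A) := by
  rw [← LinearMap.trace_conj' (A * A) g, Module.End.mul_eq_comp, Module.End.mul_eq_comp,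
    LinearEquiv.conj_comp]

theorem trace_toLin'_sq (a : Matrix (Fin n) (Fin n) ℝ) :
    LinearMap.trace ℝ _ (a.toLin' * a.toLin') = (a * a).trace := by
  rw [Module.End.mul_eq_comp, ← Matrix.toLin'_mul, Matrix.trace_toLin'_eq]

theorem phiOne_diagonal_mem :
    (Matrix.diagonal ![1, 0, 0, -1, 0, 0, -1, 1]).toLin' ∈ infinitesimalStabilizer phiOne := by
  intro v
  simp [phiOne, eee_apply, Fin.sum_univ_three, Function.update_apply, Matrix.mulVec_diagonal]
  ring

theorem phiTwo_diagonal_mem :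
    (Matrix.diagonal ![1, 1, -1, -1, 0, 0, -2, 2]).toLin' ∈ infinitesimalStabilizer phiTwo := by
  intro v
  simp [phiTwo, eee_apply, Fin.sum_univ_three, Function.update_apply, Matrix.mulVec_diagonal]
  ring

set_option maxHeartbeats 1000000 in
/-- A `4`-parameter family in the infinitesimal stabilizer of `phiTwo` on which the trace form
`A ↦ tr (A * A)` is negative definite. -/
def phiTwoNegative : (Fin 4 → ℝ) →ₗ[ℝ] Matrix (Fin 8) (Fin 8) ℝ where
  toFun t := !![0, t 0, t 1, 0, t 2, t 3, 0, t 2;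
                -t 0, 0, 0, t 1, -t 3, t 2, 0, -t 3;
                -t 1, 0, 0, t 0, -t 3, -t 2, -t 3, 0;
                0, -t 1, -t 0, 0, -t 2, t 3, -t 2, 0;
                -3 * t 2, 3 * t 3, 3 * t 3, 3 * t 2, 0, 0, 0, 0;
                -t 3, -t 2, t 2, -t 3, 0, 0, -t 1, t 1;
                0, 0, 2 * t 3, 2 * t 2, 0, 2 * t 1, 0, 0;
                -2 * t 2, 2 * t 3, 0, 0, 0, -2 * t 1, 0, 0]
  map_add' s t := by
    ext i j
    fin_cases i <;> fin_cases j <;> simp <;> ring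
  map_smul' c t := by
    ext i j
    fin_cases i <;> fin_cases j <;> simp <;> ring

set_option maxHeartbeats 1000000 in
theorem phiTwoNegative_mem (t : Fin 4 → ℝ) :
    (phiTwoNegative t).toLin' ∈ infinitesimalStabilizer phiTwo := by
  intro v
  simp [phiTwo, phiTwoNegative, eee_apply, Fin.sum_univ_three, Function.update_apply,
    dotProduct, Fin.sum_univ_eight]
  ring

theorem trace_phiTwoNegative_sq_neg {t : Fin 4 → ℝ} (ht : t ≠ 0) :
    (phiTwoNegative t * phiTwoNegative t).trace < 0 := by
  have h : (phiTwoNegative t * phiTwoNegative t).trace =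
      -(4 * t 0 ^ 2 + 12 * t 1 ^ 2 + 24 * t 2 ^ 2 + 24 * t 3 ^ 2) := by
    simp [phiTwoNegative, Matrix.trace, Fin.sum_univ_eight]
    ring
  obtain ⟨i, hi⟩ := Function.ne_iff.1 ht
  have hi : 0 < t i ^ 2 := pow_two_pos_of_ne_zero hi
  rw [h]
  fin_cases i <;> simp at hi <;>
    nlinarith [sq_nonneg (t 0), sq_nonneg (t 1),
    sq_nonneg (t 2), sq_nonneg (t 3)]

theorem trace_sq_nonpos_of_mem_infinitesimalStabilizer_phiThree {a : Matrix (Fin 8) (Fin 8) ℝ}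
    (ha : a.toLin' ∈ infinitesimalStabilizer phiThree) : (a * a).trace ≤ 0 := by
  have h : (a * a).trace = -(2 * a 0 1 ^ 2 + 2 * a 2 3 ^ 2 + 2 * (a 0 1 - a 2 3) ^ 2 +
      12 * (a 0 2 ^ 2 + a 0 3 ^ 2 + a 0 4 ^ 2 + a 0 5 ^ 2 + a 0 6 ^ 2 + a 1 6 ^ 2)) := by
    rw [eq_of_mem_infinitesimalStabilizer_phiThree ha]
    simp [Matrix.trace, Fin.sum_univ_eight]
    ring
  rw [h]
  exact neg_nonpos.2 (by positivity)

theorem trace_sq_nonneg_of_mem_infinitesimalStabilizer_phiOne {a : Matrix (Fin 8) (Fin 8) ℝ}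
    (ha : a.toLin' ∈ infinitesimalStabilizer phiOne)
    (h01 : a 0 1 = a 1 0) (h05 : a 0 5 = a 1 7) (h07 : a 0 7 = a 1 5) : 0 ≤ (a * a).trace := by
  have h : (a * a).trace = 2 * a 0 0 ^ 2 + 2 * a 4 4 ^ 2 + 2 * (a 0 0 + a 4 4) ^ 2 +
      12 * a 1 0 ^ 2 + 12 * a 1 7 ^ 2 + 6 * a 1 5 ^ 2 := by
    rw [eq_of_mem_infinitesimalStabilizer_phiOne ha]
    simp [Matrix.trace, Fin.sum_univ_eight, h01, h05, h07]
    ring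
  rw [h]
  positivity

theorem isStableForm_of_entries {γ : (Fin 8 → ℝ) [⋀^Fin 3]→ₗ[ℝ] ℝ} (p : Fin 8 → Fin 8 × Fin 8)
    (h : ∀ a : Matrix (Fin 8) (Fin 8) ℝ, a.toLin' ∈ infinitesimalStabilizer γ →
      (∀ i, a (p i).1 (p i).2 = 0) → a = 0) : IsStableForm γ := by
  refine isStableForm_of_infinitesimalStabilizer (m := 8) (by decide) (LinearMap.pi fun i =>
    Matrix.entryLinearMap ℝ ℝ (p i).1 (p i).2 ∘ₗ LinearMap.toMatrix'.toLinearMap) ?_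
  intro A hA h0
  have := h A.toMatrix' (by simpa using hA) fun i => congrFun h0 i
  simpa using this

theorem isStableForm_phiOne : IsStableForm phiOne := by
  refine isStableForm_of_entries ![(0, 0), (0, 1), (0, 5), (0, 7), (1, 0), (1, 5), (1, 7), (4, 4)]
    fun a ha h => ?_
  simp [Fin.forall_fin_succ] at h
  rw [eq_of_mem_infinitesimalStabilizer_phiOne ha, ← Matrix.ext_iff]
  simp [Fin.forall_fin_succ, h]

theorem isStableForm_phiTwo : IsStableForm phiTwo := by
  refine isStableForm_of_entries ![(0, 0), (0, 1), (0, 2), (0, 4), (0, 5), (0, 7), (1, 7), (2, 0)]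
    fun a ha h => ?_
  simp [Fin.forall_fin_succ] at h
  rw [eq_of_mem_infinitesimalStabilizer_phiTwo ha, ← Matrix.ext_iff]
  simp [Fin.forall_fin_succ, h]

theorem isStableForm_phiThree : IsStableForm phiThree := by
  refine isStableForm_of_entries ![(0, 1), (0, 2), (0, 3), (0, 4), (0, 5), (0, 6), (1, 6), (2, 3)]
    fun a ha h => ?_
  simp [Fin.forall_fin_succ] at h
  rw [eq_of_mem_infinitesimalStabilizer_phiThree ha, ← Matrix.ext_iff]
  simp [Fin.forall_fin_succ, h]

theorem not_exists_formPullback_eq_phiThree {γ : (Fin 8 → ℝ) [⋀^Fin 3]→ₗ[ℝ] ℝ} {d : Fin 8 → ℝ}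
    (hd : (Matrix.diagonal d).toLin' ∈ infinitesimalStabilizer γ) (hd0 : d ≠ 0) :
    ¬ ∃ g : (Fin 8 → ℝ) ≃ₗ[ℝ] (Fin 8 → ℝ), formPullback g.toLinearMap γ = phiThree := by
  rintro ⟨g, hg⟩
  have h := trace_sq_nonpos_of_mem_infinitesimalStabilizer_phiThree
    (a := (g.symm.conj (Matrix.diagonal d).toLin').toMatrix')
    (by simpa using conj_mem_infinitesimalStabilizer hg hd)
  rw [← trace_toLin'_sq, Matrix.toLin'_toMatrix', trace_conj_sq, trace_toLin'_sq,
    Matrix.diagonal_mul_diagonal, Matrix.trace_diagonal] at h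
  obtain ⟨i, hi⟩ := Function.ne_iff.1 hd0
  refine h.not_gt (Finset.sum_pos' (fun i _ => mul_self_nonneg (d i)) ⟨i, Finset.mem_univ i, ?_⟩)
  exact mul_self_pos.2 hi

theorem not_exists_formPullback_phiOne_eq_phiTwo :
    ¬ ∃ g : (Fin 8 → ℝ) ≃ₗ[ℝ] (Fin 8 → ℝ), formPullback g.toLinearMap phiOne = phiTwo := by
  rintro ⟨g, hg⟩
  have hg' : formPullback g.symm.toLinearMap phiTwo = phiOne := by
    rw [← hg]
    ext v
    simp [formPullback]
  let T : (Fin 4 → ℝ) →ₗ[ℝ] Matrix (Fin 8) (Fin 8) ℝ :=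
    LinearMap.toMatrix'.toLinearMap ∘ₗ g.symm.symm.conj.toLinearMap ∘ₗ
      Matrix.toLin'.toLinearMap ∘ₗ phiTwoNegative
  let e (i j : Fin 8) := Matrix.entryLinearMap ℝ ℝ i j ∘ₗ T
  obtain ⟨t, ht, ht0⟩ := Submodule.exists_mem_ne_zero_of_ne_bot
    (LinearMap.ker_ne_bot_of_finrank_lt
      (f := LinearMap.pi ![e 0 1 - e 1 0, e 0 5 - e 1 7, e 0 7 - e 1 5]) (by simp))
  have ht' := congrFun (LinearMap.mem_ker.1 ht)
  simp only [Fin.forall_fin_succ] at ht'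
  have hmem : (T t).toLin' ∈ infinitesimalStabilizer phiOne := by
    simpa [T] using conj_mem_infinitesimalStabilizer hg' (phiTwoNegative_mem t)
  have hnonneg := trace_sq_nonneg_of_mem_infinitesimalStabilizer_phiOne hmem
    (sub_eq_zero.1 ht'.1) (sub_eq_zero.1 ht'.2.1) (sub_eq_zero.1 ht'.2.2.1)
  have htrace : (T t * T t).trace = (phiTwoNegative t * phiTwoNegative t).trace := by
    rw [← trace_toLin'_sq, ← trace_toLin'_sq]
    simpa [T] using trace_conj_sq g (phiTwoNegative t).toLin'
  exact (htrace ▸ hnonneg).not_gt (trace_phiTwoNegative_sq_neg ht0)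

/-- `φ₁`, `φ₂`, `φ₃` are stable and pairwise inequivalent. -/
theorem phi_stable_pairwise_not_equivalent :
    IsStableForm phiOne ∧ IsStableForm phiTwo ∧ IsStableForm phiThree ∧
    (¬ ∃ g : (Fin 8 → ℝ) ≃ₗ[ℝ] (Fin 8 → ℝ), formPullback g.toLinearMap phiOne = phiTwo) ∧
    (¬ ∃ g : (Fin 8 → ℝ) ≃ₗ[ℝ] (Fin 8 → ℝ), formPullback g.toLinearMap phiOne = phiThree) ∧
    (¬ ∃ g : (Fin 8 → ℝ) ≃ₗ[ℝ] (Fin 8 → ℝ), formPullback g.toLinearMap phiTwo = phiThree) := by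
  exact ⟨isStableForm_phiOne, isStableForm_phiTwo, isStableForm_phiThree,
    not_exists_formPullback_phiOne_eq_phiTwo,
    not_exists_formPullback_eq_phiThree phiOne_diagonal_mem fun h => by simpa using congrFun h 0,
    not_exists_formPullback_eq_phiThree phiTwo_diagonal_mem fun h => by simpa using congrFun h 0⟩
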